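/- Suppose C is a nonsingular projective curve of genus g over an algebraically closed field K, and 𝓜, 𝓝 are line bundles on C with deg(𝓜) ≥ 2(2g+1) and deg(𝓝) ≥ 2(2g+1). Then the natural multiplication map Γ(C, 𝓜) ⊗ Γ(C, 𝓝) → Γ(C, 𝓜 ⊗ 𝓝) is surjective. -/

import Mathlib

/-!
# Statement 13

A nonsingular projective curve `C` of genus `g` over an algebraically closed field `K` is
encoded by its function field `F = K(C)`: a finitely generated field extension of `K` of
transcendence degree 1.  Closed points of `C` correspond to the places of `F/K`, i.e. the
normalized discrete valuations of `F` trivial on `K`; line bundles correspond to divisors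
(finitely supported `ℤ`-valued functions on places), global sections `Γ(C, 𝓛)` to the
Riemann–Roch space `L(D)`, the degree of a line bundle to the degree of a divisor (over an
algebraically closed field all residue degrees are 1), and the genus is the maximal value
of `deg D + 1 - dim_K L(D)` over all divisors `D`.
-/

noncomputable section

namespace FunctionFieldCurve

variable (K F : Type) [Field K] [Field F] [Algebra K F]

/-- A place of the function field `F` over `K`: a normalized (surjective) discrete
valuation on `F` which is trivial on `K`.  These correspond to the closed points of the
nonsingular projective model of `F/K`. -/
def Place : Type :=
  {v : Valuation F (WithZero (Multiplicative ℤ)) //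
    Function.Surjective v ∧ ∀ c : K, c ≠ 0 → v (algebraMap K F c) = 1}

/-- A divisor on the curve: a finitely supported `ℤ`-valued function on places. -/
abbrev Divisor : Type := Place K F →₀ ℤ

/-- The Riemann–Roch space `L(D) = {f ∈ F | div(f) + D ≥ 0}` of a divisor `D`; it is the
space of global sections `Γ(C, 𝓛)` of the line bundle `𝓛 = O_C(D)` associated to `D`. -/
def LSpace (D : Divisor K F) : Submodule K F where
  carrier := {f | ∀ v : Place K F,
    v.1 f ≤ (Multiplicative.ofAdd (D v) : Multiplicative ℤ)}
  add_mem' := by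
    intro f h hf hh v
    exact le_trans (v.1.map_add f h) (max_le (hf v) (hh v))
  zero_mem' := by
    intro v
    simp only [Set.mem_setOf_eq, Valuation.map_zero]
    exact zero_le'
  smul_mem' := by
    intro c f hf v
    rw [Algebra.smul_def, Valuation.map_mul]
    by_cases hc : c = 0
    · simp [hc]
    · rw [v.2.2 c hc, one_mul]
      exact hf v
/-- The degree of a divisor.  (Over an algebraically closed base field all residue
degrees are 1, so the degree is just the sum of the coefficients.) -/
def degD (D : Divisor K F) : ℤ := D.sum fun _ n => n

end FunctionFieldCurve

namespace FunctionFieldCurve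

open WithZero

section Residue

variable {K F : Type} [Field K] [Field F] [Algebra K F]

theorem Place.map_algebraMap_le_one (v : Place K F) (c : K) : v.1 (algebraMap K F c) ≤ 1 := by
  by_cases hc : c = 0
  · simp [hc]
  · exact (v.2.2 c hc).le

/-- If the reduction of `f` at `v` avoids every element of the algebraically closed field `K`,
then `v` is trivial on the polynomials in `f`. -/
theorem Place.map_aeval_eq_one [IsAlgClosed K] (v : Place K F) {f : F}
    (hf : ∀ c : K, v.1 (f - algebraMap K F c) = 1) {p : Polynomial K} (hp : p ≠ 0) :
    v.1 (Polynomial.aeval f p) = 1 := by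
  conv_lhs => rw [(IsAlgClosed.splits p).eq_prod_roots]
  rw [map_mul, Polynomial.aeval_C, map_mul,
    v.2.2 _ (Polynomial.leadingCoeff_ne_zero.mpr hp), one_mul, map_multiset_prod,
    map_multiset_prod, Multiset.map_map, Multiset.map_map]
  apply Multiset.prod_eq_one
  intro x hx
  obtain ⟨a, -, rfl⟩ := Multiset.mem_map.mp hx
  simpa using hf a

theorem isAlgebraic_adjoin_singleton
    (htr : ∃ x : F, Transcendental K x ∧
      Algebra.IsAlgebraic (IntermediateField.adjoin K {x}) F)
    {f : F} (hf : Transcendental K f) : Algebra.IsAlgebraic (Algebra.adjoin K {f}) F := by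
  obtain ⟨x, -, hx⟩ := htr
  have hx' : Algebra.IsAlgebraic (Algebra.adjoin K {x}) F := by
    open scoped IntermediateField.algebraAdjoinAdjoin in
    exact (IsFractionRing.comap_isAlgebraic_iff (A := Algebra.adjoin K {x})
      (K := IntermediateField.adjoin K {x})).mpr hx
  have htrdeg : Algebra.trdeg K F ≤ 1 := by
    simpa using Algebra.IsAlgebraic.trdeg_le_cardinalMk K ({x} : Set F)
  have hind : AlgebraicIndependent K (fun _ : Unit => f) :=
    (algebraicIndependent_unique_type_iff).mpr hf
  have := (hind.isTranscendenceBasis_of_trdeg_le_of_finite (by simpa using htrdeg)).isAlgebraic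
  rwa [Set.range_const] at this

/-- The residue field of every place is the algebraically closed field of constants. -/
theorem exists_residue [IsAlgClosed K]
    (htr : ∃ x : F, Transcendental K x ∧
      Algebra.IsAlgebraic (IntermediateField.adjoin K {x}) F)
    (v : Place K F) {f : F} (hf : v.1 f ≤ 1) : ∃ c : K, v.1 (f - algebraMap K F c) < 1 := by
  by_contra! hcon
  have hone : ∀ c : K, v.1 (f - algebraMap K F c) = 1 := fun c =>
    le_antisymm ((v.1.map_sub _ _).trans (max_le hf (v.map_algebraMap_le_one c))) (hcon c)
  have htf : Transcendental K f := by
    rintro ⟨p, hp, h0⟩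
    simpa [h0] using v.map_aeval_eq_one hone hp
  have halg := isAlgebraic_adjoin_singleton htr htf
  have hle : ∀ a : Algebra.adjoin K {f}, v.1 (a : F) ≤ 1 ∧ (a ≠ 0 → v.1 (a : F) = 1) := by
    rintro ⟨a, ha⟩
    rw [Algebra.adjoin_singleton_eq_range_aeval] at ha
    obtain ⟨p, rfl⟩ := ha
    by_cases hp : p = 0
    · subst hp
      refine ⟨by simp, fun h => (h ?_).elim⟩
      ext
      simp
    · have := v.map_aeval_eq_one hone hp
      exact ⟨this.le, fun _ => this⟩
  obtain ⟨π, hπ⟩ := v.2.1 (exp (-1))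
  have hπ0 : π ≠ 0 := by
    rintro rfl
    rw [map_zero] at hπ
    exact exp_ne_zero hπ.symm
  have hπ1 : v.1 π < 1 := by
    rw [hπ, ← exp_zero, exp_lt_exp]
    norm_num
  obtain ⟨q, hq0, hq⟩ := (halg.isAlgebraic π).exists_nonzero_coeff_and_aeval_eq_zero
    (mem_nonZeroDivisors_of_ne_zero hπ0)
  rw [← Polynomial.divX_mul_X_add q, map_add, map_mul, Polynomial.aeval_X, Polynomial.aeval_C]
    at hq
  have hdiv : v.1 (Polynomial.aeval π q.divX) ≤ 1 := by
    rw [Polynomial.aeval_eq_sum_range]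
    refine v.1.map_sum_le fun i _ => ?_
    rw [Algebra.smul_def, map_mul, map_pow]
    exact mul_le_one' (hle _).1 (pow_le_one' hπ1.le i)
  have h1 : v.1 (algebraMap (Algebra.adjoin K {f}) F (q.coeff 0)) = 1 := (hle _).2 hq0
  rw [eq_neg_of_add_eq_zero_right hq, Valuation.map_neg, map_mul] at h1
  exact ((mul_le_of_le_one_left zero_le hdiv).trans_lt hπ1).ne h1

end Residue
section RiemannRoch

variable {K F : Type} [Field K] [Field F] [Algebra K F]

theorem mem_LSpace {D : Divisor K F} {f : F} :
    f ∈ LSpace K F D ↔ ∀ v : Place K F, v.1 f ≤ exp (D v) := Iff.rfl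

theorem degD_add (D E : Divisor K F) : degD K F (D + E) = degD K F D + degD K F E :=
  Finsupp.sum_add_index' (fun _ => rfl) fun _ _ _ => rfl

theorem degD_zero : degD K F 0 = 0 := Finsupp.sum_zero_index

theorem degD_single (v : Place K F) (n : ℤ) : degD K F (Finsupp.single v n) = n :=
  Finsupp.sum_single_index rfl

theorem degD_sub (D E : Divisor K F) : degD K F (D - E) = degD K F D - degD K F E := by
  rw [eq_sub_iff_add_eq, ← degD_add, sub_add_cancel]

theorem degD_sum_single (s : Finset (Place K F)) :
    degD K F (∑ v ∈ s, Finsupp.single v 1) = s.card := by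
  classical
  induction s using Finset.induction_on with
  | empty => simp [degD_zero]
  | insert a s ha ih =>
    rw [Finset.sum_insert ha, degD_add, ih, degD_single, Finset.card_insert_of_notMem ha]
    push_cast
    ring

theorem sum_single_apply [DecidableEq (Place K F)] (s : Finset (Place K F)) (w : Place K F) :
    (∑ v ∈ s, Finsupp.single v (1 : ℤ)) w = if w ∈ s then 1 else 0 := by
  simp [Finsupp.finsetSum_apply, Finsupp.single_apply]

theorem degD_nonneg {D : Divisor K F} (hD : 0 ≤ D) : 0 ≤ degD K F D :=
  Finset.sum_nonneg fun v _ => hD v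

theorem LSpace_mono {D D' : Divisor K F} (h : D ≤ D') : LSpace K F D ≤ LSpace K F D' :=
  fun _ hf v => (hf v).trans (exp_le_exp.mpr (h v))

theorem sub_single_le (D : Divisor K F) (v : Place K F) : D - Finsupp.single v 1 ≤ D :=
  sub_le_self _ (Finsupp.single_nonneg.mpr zero_le_one)

theorem le_exp_sub_one {x : WithZero (Multiplicative ℤ)} {n : ℤ} (h : x < exp n) :
    x ≤ exp (n - 1) := by
  by_cases hx : x = 0
  · simp [hx]
  · rw [← log_lt_iff_lt_exp hx] at h
    rw [← log_le_iff_le_exp hx]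
    omega

theorem mem_LSpace_sub_single {D : Divisor K F} {f : F} {v : Place K F}
    (hf : f ∈ LSpace K F D) (hv : v.1 f < exp (D v)) :
    f ∈ LSpace K F (D - Finsupp.single v 1) := by
  classical
  intro w
  change _ ≤ exp ((D - Finsupp.single v 1 : Divisor K F) w)
  by_cases hw : w = v
  · subst hw
    simpa using le_exp_sub_one hv
  · simpa [Finsupp.single_apply, Ne.symm hw] using mem_LSpace.mp hf w

theorem mul_mem_LSpace {D E : Divisor K F} {f h : F} (hf : f ∈ LSpace K F D)
    (hh : h ∈ LSpace K F E) : f * h ∈ LSpace K F (D + E) := by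
  intro v
  rw [map_mul, Finsupp.add_apply]
  exact mul_le_mul' (hf v) (hh v)

variable (K F) in
/-- The facts about a curve with rational points of genus `g` from which the elementary part of
the Riemann–Roch theorem follows: places have residue field `K`, and Riemann's inequality
`deg D + 1 - g ≤ dim L(D)` holds and is an equality for some divisor. -/
structure IsGenus (g : ℕ) : Prop where
  nonempty : Nonempty (Place K F)
  exists_residue : ∀ (v : Place K F) (f : F), v.1 f ≤ 1 →
    ∃ c : K, v.1 (f - algebraMap K F c) < 1
  riemann : ∀ D : Divisor K F, degD K F D + 1 - Module.finrank K (LSpace K F D) ≤ g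
  exists_nonspecial : ∃ D : Divisor K F, (g : ℤ) = degD K F D + 1 - Module.finrank K (LSpace K F D)

namespace IsGenus

variable {g : ℕ} (H : IsGenus K F g)

include H

theorem finite_LSpace (D : Divisor K F) : Module.Finite K (LSpace K F D) := by
  by_contra hD
  obtain ⟨v⟩ := H.nonempty
  set n : ℕ := (g - degD K F D).toNat
  have hle : D ≤ D + Finsupp.single v (n : ℤ) :=
    le_add_of_nonneg_right (Finsupp.single_nonneg.mpr (by positivity))
  have hinf : ¬ Module.Finite K (LSpace K F (D + Finsupp.single v (n : ℤ))) := fun _ =>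
    hD (Submodule.finiteDimensional_of_le (LSpace_mono hle))
  have h := H.riemann (D + Finsupp.single v (n : ℤ))
  rw [Module.finrank_of_not_finite hinf, degD_add, degD_single] at h
  omega

theorem finrank_LSpace_le_of_le {D D' : Divisor K F} (h : D ≤ D') :
    Module.finrank K (LSpace K F D) ≤ Module.finrank K (LSpace K F D') :=
  have := H.finite_LSpace D'
  Submodule.finrank_mono (LSpace_mono h)

theorem finrank_LSpace_le_finrank_sub_single_add_one (D : Divisor K F) (v : Place K F) :
    Module.finrank K (LSpace K F D) ≤
      Module.finrank K (LSpace K F (D - Finsupp.single v 1)) + 1 := by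
  have := H.finite_LSpace D
  have := H.finite_LSpace (D - Finsupp.single v 1)
  by_cases hex : ∃ h ∈ LSpace K F D, h ∉ LSpace K F (D - Finsupp.single v 1)
  · obtain ⟨h, hD, hnot⟩ := hex
    have hv : v.1 h = exp (D v) :=
      le_antisymm (hD v) (not_lt.mp fun hlt => hnot (mem_LSpace_sub_single hD hlt))
    have hle : LSpace K F D ≤ LSpace K F (D - Finsupp.single v 1) ⊔ K ∙ h := by
      intro f hf
      have hh0 : h ≠ 0 := fun h0 => hnot (h0 ▸ Submodule.zero_mem _)
      obtain ⟨c, hc⟩ := H.exists_residue v (f / h) (by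
        rw [map_div₀, hv]
        exact div_le_one_of_le₀ (hf v) zero_le)
      refine Submodule.mem_sup.mpr ⟨f - c • h, ?_, c • h,
        Submodule.smul_mem _ _ (Submodule.mem_span_singleton_self h), sub_add_cancel _ _⟩
      refine mem_LSpace_sub_single (Submodule.sub_mem _ hf (Submodule.smul_mem _ c hD)) ?_
      have heq : f - c • h = (f / h - algebraMap K F c) * h := by
        rw [Algebra.smul_def]
        field_simp
      rw [heq, map_mul, hv]
      exact mul_lt_of_lt_one_left exp_pos hc
    calc _ ≤ _ := Submodule.finrank_mono hle
      _ ≤ _ := Submodule.finrank_add_le_finrank_add_finrank _ _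
      _ ≤ _ := Nat.add_le_add_left
        (by simpa using finrank_span_le_card (R := K) ({h} : Set F)) _
  · push Not at hex
    exact (Submodule.finrank_mono hex).trans (Nat.le_succ _)

theorem finrank_LSpace_sub_degD_antitone {D D' : Divisor K F} (h : D ≤ D') :
    (Module.finrank K (LSpace K F D') : ℤ) - degD K F D' ≤
      Module.finrank K (LSpace K F D) - degD K F D := by
  obtain ⟨n, hn⟩ := Int.eq_ofNat_of_zero_le (degD_nonneg (sub_nonneg.mpr h))
  induction n generalizing D' with
  | zero =>
    have : D' - D = 0 := by
      ext v
      by_contra hv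
      have hle : Finsupp.single v 1 ≤ D' - D := by
        classical
        intro w
        by_cases hw : v = w
        · subst hw
          have := h v
          simp at hv ⊢
          omega
        · simpa [Finsupp.single_apply, hw] using h w
      have := degD_nonneg (sub_nonneg.mpr hle)
      rw [degD_sub, degD_single] at this
      omega
    rw [sub_eq_zero.mp this]
  | succ n ih =>
    have hex : ∃ v, D v < D' v := by
      by_contra! hcon
      rw [le_antisymm (show D' ≤ D from hcon) h, sub_self, degD_zero] at hn
      omega
    obtain ⟨v, hv⟩ := hex
    have hle : D ≤ D' - Finsupp.single v 1 := by
      classical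
      intro w
      by_cases hw : v = w
      · subst hw
        simp
        omega
      · simpa [Finsupp.single_apply, hw] using h w
    have h1 := ih hle (by rw [degD_sub, degD_sub, degD_single] at *; omega)
    have h2 := H.finrank_LSpace_le_finrank_sub_single_add_one D' v
    rw [degD_sub, degD_single] at h1
    omega

theorem finrank_LSpace_le_of_mul_mem {D D' : Divisor K F} {f : F} (hf : f ≠ 0)
    (h : ∀ t ∈ LSpace K F D, f * t ∈ LSpace K F D') :
    Module.finrank K (LSpace K F D) ≤ Module.finrank K (LSpace K F D') := by
  have := H.finite_LSpace D'
  refine LinearMap.finrank_le_finrank_of_injective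
    (f := (LinearMap.mulLeft K f).restrict h) fun a b hab => ?_
  exact Subtype.ext (mul_left_cancel₀ hf (congrArg Subtype.val hab))

theorem degD_nonneg_of_mem {D : Divisor K F} {f : F} (hf : f ≠ 0) (hD : f ∈ LSpace K F D) :
    0 ≤ degD K F D := by
  obtain ⟨D₀, h₀⟩ := H.exists_nonspecial
  have h1 := H.riemann (D₀ - D)
  have h2 := H.finrank_LSpace_le_of_mul_mem (D := D₀ - D) (D' := D₀) hf fun t ht => by
    simpa using mul_mem_LSpace hD ht
  rw [degD_sub] at h1
  omega

theorem finite_zeros {A : Divisor K F} {f : F} (hf : f ≠ 0) (hA : f ∈ LSpace K F A) :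
    {v : Place K F | v.1 f < exp (A v)}.Finite := by
  classical
  by_contra hinf
  obtain ⟨T, hT, hcard⟩ := Set.Infinite.exists_subset_card_eq hinf ((degD K F A).toNat + 1)
  have hmem : f ∈ LSpace K F (A - ∑ v ∈ T, Finsupp.single v 1) := by
    intro v
    change _ ≤ exp ((A - ∑ v ∈ T, Finsupp.single v 1 : Divisor K F) v)
    rw [Finsupp.sub_apply, sum_single_apply]
    split_ifs with hv
    · exact le_exp_sub_one (hT hv)
    · simpa using mem_LSpace.mp hA v
  have := H.degD_nonneg_of_mem hf hmem
  rw [degD_sub, degD_sum_single, hcard] at this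
  omega

theorem exists_divisor_of_zeros {A : Divisor K F} {f : F} (hf : f ≠ 0) (hA : f ∈ LSpace K F A) :
    ∃ E : Divisor K F, 0 ≤ E ∧ degD K F E = degD K F A ∧
      ∀ v : Place K F, v.1 f = exp (A v - E v) := by
  have hv0 : ∀ v : Place K F, v.1 f ≠ 0 := fun v => (Valuation.ne_zero_iff _).mpr hf
  let E : Divisor K F := Finsupp.onFinset (H.finite_zeros hf hA).toFinset
    (fun v => A v - log (v.1 f)) (by
      intro v hv
      refine (Set.Finite.mem_toFinset _).mpr (lt_of_le_of_ne (hA v) fun h => hv ?_)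
      rw [h]
      exact sub_self (A v))
  have hE : ∀ v : Place K F, v.1 f = exp (A v - E v) := fun v => by
    rw [show A v - E v = log (v.1 f) from sub_sub_cancel _ _, exp_log (hv0 v)]
  refine ⟨E, fun v => ?_, ?_, hE⟩
  · exact sub_nonneg.mpr ((log_le_iff_le_exp (hv0 v)).mpr (hA v))
  · have h1 := H.degD_nonneg_of_mem (D := A - E) hf fun v => (hE v).le
    have h2 := H.degD_nonneg_of_mem (D := E - A) (inv_ne_zero hf) fun v => by
      rw [map_inv₀, hE v, ← exp_neg, neg_sub]
      exact le_rfl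
    rw [degD_sub] at h1 h2
    omega

theorem exists_eq_algebraMap {f : F} (hf : f ∈ LSpace K F 0) : ∃ c : K, algebraMap K F c = f := by
  obtain ⟨v⟩ := H.nonempty
  obtain ⟨c, hc⟩ := H.exists_residue v f (hf v)
  refine ⟨c, ?_⟩
  by_contra hne
  have hmem : f - algebraMap K F c ∈ LSpace K F 0 :=
    Submodule.sub_mem _ hf fun w => w.map_algebraMap_le_one c
  have := H.degD_nonneg_of_mem (sub_ne_zero.mpr (Ne.symm hne)) (mem_LSpace_sub_single hmem hc)
  rw [degD_sub, degD_single, degD_zero] at this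
  omega

theorem infinite_place [Infinite K] : Infinite (Place K F) := by
  obtain ⟨v₀⟩ := H.nonempty
  have hex : ∃ f ∈ LSpace K F (Finsupp.single v₀ (g + 1)), f ∉ K ∙ (1 : F) := by
    by_contra! hcon
    have h1 := (Submodule.finrank_mono hcon).trans
      (finrank_span_le_card (R := K) ({1} : Set F))
    have h2 := H.riemann (Finsupp.single v₀ (g + 1))
    rw [degD_single] at h2
    simp at h1
    omega
  obtain ⟨f, -, hf⟩ := hex
  have hf' : ∀ c : K, algebraMap K F c ≠ f := fun c hc =>
    hf (Submodule.mem_span_singleton.mpr ⟨c, by rw [← hc, Algebra.smul_def, mul_one]⟩)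
  have hzero : ∀ c : K, ∃ v : Place K F, v.1 (f - algebraMap K F c) < 1 := by
    intro c
    by_contra! hcon
    obtain ⟨b, hb⟩ := H.exists_eq_algebraMap (f := (f - algebraMap K F c)⁻¹) fun v => by
      rw [map_inv₀]
      exact inv_le_one_of_one_le₀ (hcon v)
    refine hf' (b⁻¹ + c) ?_
    rw [map_add, map_inv₀, hb, inv_inv, sub_add_cancel]
  choose φ hφ using hzero
  refine Infinite.of_injective φ fun a b hab => ?_
  by_contra hne
  have h1 : (φ a).1 (algebraMap K F (a - b)) < 1 := by
    have : algebraMap K F (a - b) = (f - algebraMap K F b) - (f - algebraMap K F a) := by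
      rw [map_sub]
      ring
    rw [this]
    exact (Valuation.map_sub _ _ _).trans_lt (max_lt (hab ▸ hφ b) (hφ a))
  exact h1.ne ((φ a).2.2 _ (sub_ne_zero.mpr hne))

theorem exists_finrank_LSpace_eq_zero [Infinite K] :
    ∃ D : Divisor K F, degD K F D + 1 = g ∧ Module.finrank K (LSpace K F D) = 0 := by
  obtain ⟨D, hD⟩ := H.exists_nonspecial
  induction hn : Module.finrank K (LSpace K F D) generalizing D with
  | zero => exact ⟨D, by omega, hn⟩
  | succ n ih =>
    have := H.infinite_place
    obtain ⟨f, hfD, hf⟩ := (LSpace K F D).exists_mem_ne_zero_of_ne_bot (by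
      rintro h
      rw [h, finrank_bot] at hn
      omega)
    obtain ⟨v, hv⟩ := (H.finite_zeros hf hfD).exists_notMem
    have hlt : Module.finrank K (LSpace K F (D - Finsupp.single v 1)) <
        Module.finrank K (LSpace K F D) := by
      have := H.finite_LSpace D
      refine Submodule.finrank_lt_finrank_of_lt
        (lt_of_le_of_ne (LSpace_mono (sub_single_le D v)) fun h => hv ?_)
      rw [← h] at hfD
      refine (mem_LSpace.mp hfD v).trans_lt ?_
      simp [-exp_sub]
    have hle := H.finrank_LSpace_le_finrank_sub_single_add_one D v
    have hdeg := degD_sub D (Finsupp.single v 1)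
    rw [degD_single] at hdeg
    exact ih (D - Finsupp.single v 1) (by omega) (by omega)

theorem finrank_LSpace [Infinite K] {D : Divisor K F} (hD : 2 * (g : ℤ) - 1 ≤ degD K F D) :
    (Module.finrank K (LSpace K F D) : ℤ) = degD K F D + 1 - g := by
  obtain ⟨D₀, hdeg, h₀⟩ := H.exists_finrank_LSpace_eq_zero
  have hr := H.riemann (D - D₀)
  have hsub := degD_sub D D₀
  obtain ⟨f, hfD, hf⟩ := (LSpace K F (D - D₀)).exists_mem_ne_zero_of_ne_bot (by
    rintro h
    rw [h, finrank_bot] at hr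
    omega)
  obtain ⟨E, hE, hdegE, hfE⟩ := H.exists_divisor_of_zeros hf hfD
  have h1 := H.finrank_LSpace_sub_degD_antitone (le_add_of_nonneg_right hE : D₀ ≤ D₀ + E)
  have h2 := H.finrank_LSpace_le_of_mul_mem (D := D) (D' := D₀ + E) (inv_ne_zero hf) fun t ht => by
    have hinv : f⁻¹ ∈ LSpace K F (D₀ + E - D) := fun v => by
      rw [map_inv₀, hfE v, ← exp_neg]
      refine exp_le_exp.mpr (le_of_eq ?_)
      simp only [Finsupp.sub_apply, Finsupp.add_apply]
      ring
    simpa using mul_mem_LSpace hinv ht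
  have h3 := H.riemann D
  rw [degD_add] at h1
  omega

theorem exists_pencil [Infinite K] {A : Divisor K F} (hA : 2 * (g : ℤ) ≤ degD K F A) :
    ∃ f ∈ LSpace K F A, ∃ h ∈ LSpace K F A, f ≠ 0 ∧
      ∀ v : Place K F, v.1 f = exp (A v) ∨ v.1 h = exp (A v) := by
  have hr := H.finrank_LSpace (D := A) (by omega)
  obtain ⟨f, hfA, hf⟩ := (LSpace K F A).exists_mem_ne_zero_of_ne_bot (by
    rintro h
    rw [h, finrank_bot] at hr
    omega)
  have := (H.finite_zeros hf hfA).to_subtype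
  let p : {v : Place K F | v.1 f < exp (A v)} → Submodule K (LSpace K F A) := fun v =>
    (LSpace K F (A - Finsupp.single v.1 1)).comap (LSpace K F A).subtype
  have hp : ⋃ i, (p i : Set (LSpace K F A)) ≠ Set.univ := by
    intro hcov
    obtain ⟨v, hv⟩ := Subspace.exists_eq_top_of_iUnion_eq_univ hcov
    have hle := Submodule.comap_subtype_eq_top.mp hv
    have := H.finite_LSpace (A - Finsupp.single v.1 1)
    have h1 := Submodule.finrank_mono hle
    have hdeg := degD_sub A (Finsupp.single v.1 1)
    rw [degD_single] at hdeg
    have h2 := H.finrank_LSpace (D := A - Finsupp.single v.1 1) (by omega)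
    omega
  obtain ⟨h, hh⟩ := (Set.ne_univ_iff_exists_notMem _).mp hp
  refine ⟨f, hfA, h, h.2, hf, fun v => or_iff_not_imp_left.mpr fun hv => ?_⟩
  refine le_antisymm (h.2 v) (not_lt.mp fun hlt => hh ?_)
  exact Set.mem_iUnion.mpr ⟨⟨v, lt_of_le_of_ne (hfA v) hv⟩, mem_LSpace_sub_single h.2 hlt⟩

/-- The base-point-free pencil trick. -/
theorem LSpace_add_le_mul [Infinite K] {A B : Divisor K F} (hA : 2 * (g : ℤ) ≤ degD K F A)
    (hB : degD K F A + 2 * (g : ℤ) - 1 ≤ degD K F B) :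
    LSpace K F (A + B) ≤ LSpace K F A * LSpace K F B := by
  obtain ⟨f, hf, h, hh, hf0, hfh⟩ := H.exists_pencil hA
  have := H.finite_LSpace B
  have := H.finite_LSpace (B - A)
  have := H.finite_LSpace (A + B)
  let φ : (LSpace K F B × LSpace K F B) →ₗ[K] F :=
    ((LinearMap.mulLeft K f).comp (LSpace K F B).subtype).coprod
      ((LinearMap.mulLeft K h).comp (LSpace K F B).subtype)
  have hφ : ∀ x, φ x = f * x.1 + h * x.2 := fun x => rfl
  have hrange : LinearMap.range φ ≤ LSpace K F (A + B) := by
    rintro _ ⟨x, rfl⟩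
    exact Submodule.add_mem _ (mul_mem_LSpace hf x.1.2) (mul_mem_LSpace hh x.2.2)
  have hrange' : LinearMap.range φ ≤ LSpace K F A * LSpace K F B := by
    rintro _ ⟨x, rfl⟩
    exact Submodule.add_mem _ (Submodule.mul_mem_mul hf x.1.2) (Submodule.mul_mem_mul hh x.2.2)
  let ψ : LinearMap.ker φ →ₗ[K] F := (LinearMap.mulLeft K f⁻¹).comp
    ((LSpace K F B).subtype.comp ((LinearMap.snd K _ _).comp (LinearMap.ker φ).subtype))
  have hψ : ∀ x, ψ x = f⁻¹ * x.1.2 := fun x => rfl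
  have hker : ∀ x : LinearMap.ker φ, (x.1.1 : F) = -(ψ x * h) := by
    intro x
    have := LinearMap.mem_ker.mp x.2
    rw [hφ] at this
    rw [hψ]
    field_simp
    linear_combination this
  have hψmem : ∀ x, ψ x ∈ LSpace K F (B - A) := by
    intro x v
    have key : ∀ s t : F, t ∈ LSpace K F B → v.1 s = exp (A v) → v.1 t = v.1 (ψ x * s) →
        v.1 (ψ x) ≤ exp ((B - A) v) := by
      intro s t ht hs hst
      have := mem_LSpace.mp ht v
      rw [hst, map_mul, hs] at this
      rw [Finsupp.sub_apply, exp_sub]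
      exact (le_div_iff₀ exp_pos).mpr this
    rcases hfh v with hv | hv
    · refine key f _ x.1.2.2 hv ?_
      rw [hψ, mul_comm, mul_inv_cancel_left₀ hf0]
    · refine key h _ x.1.1.2 hv ?_
      rw [hker, Valuation.map_neg]
  have hinj : Function.Injective (ψ.codRestrict _ hψmem) := by
    intro x y hxy
    have h2 : ψ x = ψ y := congrArg Subtype.val hxy
    refine Subtype.ext (Prod.ext (Subtype.ext ?_) (Subtype.ext ?_))
    · rw [hker, hker, h2]
    · rw [hψ, hψ] at h2
      exact mul_left_cancel₀ (inv_ne_zero hf0) h2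
  have h1 := LinearMap.finrank_le_finrank_of_injective hinj
  have h2 := LinearMap.finrank_range_add_finrank_ker φ
  rw [Module.finrank_prod] at h2
  have hsub := degD_sub B A
  have hadd := degD_add A B
  have h3 := H.finrank_LSpace (D := B - A) (by omega)
  have h4 := H.finrank_LSpace (D := A + B) (by omega)
  have h5 := H.finrank_LSpace (D := B) (by omega)
  rw [← Submodule.eq_of_le_of_finrank_le hrange (by omega)]
  exact hrange'

theorem LSpace_add_le_mul_of_degD_le [Infinite K] {D E : Divisor K F}
    (hD : 2 * (2 * (g : ℤ) + 1) ≤ degD K F D) (hDE : degD K F D ≤ degD K F E) :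
    LSpace K F (D + E) ≤ LSpace K F D * LSpace K F E := by
  obtain ⟨v⟩ := H.nonempty
  set A : Divisor K F := Finsupp.single v (2 * g + 1) with hA
  have hdegA : degD K F A = 2 * g + 1 := degD_single _ _
  have hsub := degD_sub D A
  have hadd := degD_add A E
  calc LSpace K F (D + E) = LSpace K F ((D - A) + (A + E)) := by
        rw [← add_assoc, sub_add_cancel]
    _ ≤ LSpace K F (D - A) * LSpace K F (A + E) :=
        H.LSpace_add_le_mul (by omega) (by omega)
    _ ≤ LSpace K F (D - A) * (LSpace K F A * LSpace K F E) :=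
        mul_le_mul' le_rfl (H.LSpace_add_le_mul (by omega) (by omega))
    _ = (LSpace K F (D - A) * LSpace K F A) * LSpace K F E := (mul_assoc _ _ _).symm
    _ ≤ LSpace K F D * LSpace K F E := by
        refine mul_le_mul' (Submodule.mul_le.mpr fun s hs t ht => ?_) le_rfl
        simpa using mul_mem_LSpace hs ht

end IsGenus

end RiemannRoch

end FunctionFieldCurve

open FunctionFieldCurve in
/-- Let `C` be a nonsingular projective curve of genus `g` over an
algebraically closed field `K`, with function field `F` (a finitely generated extension of
`K` of transcendence degree 1, with the genus `g` characterized as the maximum of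
`deg D + 1 - dim_K L(D)`).  If `𝓜 = O(D)` and `𝓝 = O(E)` are line bundles of degree
`≥ 2(2g+1)`, then the multiplication map `Γ(C,𝓜) ⊗ Γ(C,𝓝) → Γ(C, 𝓜 ⊗ 𝓝)`,
i.e. `L(D) ⊗ L(E) → L(D+E)`, is surjective. -/
theorem sections_multiplication_surjective (K F : Type) [Field K] [IsAlgClosed K]
    [Field F] [Algebra K F]
    (hfg : ∃ s : Finset F, IntermediateField.adjoin K (s : Set F) = ⊤)
    (htr : ∃ x : F, Transcendental K x ∧
      Algebra.IsAlgebraic (IntermediateField.adjoin K {x}) F)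
    (g : ℕ)
    (hg : IsGreatest {z : ℤ | ∃ D : Divisor K F,
      z = degD K F D + 1 - (Module.finrank K ↥(LSpace K F D) : ℤ)} (g : ℤ))
    (D E : Divisor K F)
    (hD : 2 * (2 * (g : ℤ) + 1) ≤ degD K F D)
    (hE : 2 * (2 * (g : ℤ) + 1) ≤ degD K F E) :
    LSpace K F (D + E) ≤
      Submodule.span K {x : F | ∃ f ∈ LSpace K F D, ∃ h ∈ LSpace K F E, x = f * h} := by
  have hne : Nonempty (Place K F) := by
    by_contra hempty
    rw [not_nonempty_iff] at hempty
    rw [Subsingleton.elim D 0, degD_zero] at hD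
    omega
  have H : IsGenus K F g := ⟨hne, fun v _ hf => exists_residue htr v hf,
    fun D => hg.2 ⟨D, rfl⟩, hg.1⟩
  have : Infinite K := IsAlgClosed.instInfinite
  have hmul : LSpace K F (D + E) ≤ LSpace K F D * LSpace K F E := by
    rcases le_total (degD K F D) (degD K F E) with h | h
    · exact H.LSpace_add_le_mul_of_degD_le hD h
    · rw [add_comm, mul_comm]
      exact H.LSpace_add_le_mul_of_degD_le hE h
  refine hmul.trans (Submodule.mul_le.mpr fun f hf h hh => ?_)
  exact Submodule.subset_span ⟨f, hf, h, hh, rfl⟩
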